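/- Let n ≥ 1 and let A be an elasticity Z-tensor. The following are equivalent: (1) A is a nonsingular elasticity M-tensor; (2) for every nonzero x ∈ ℝ^n with x ≥ 0 there exists y ∈ ℝ^n with y > 0 such that the vector A x² y is componentwise positive; (3) for every nonzero x ∈ ℝ^n with x ≥ 0 there exists y ∈ ℝ^n with y ≥ 0 such that the vector A x² y is componentwise positive. -/

import Mathlib

open Finset

noncomputable section

/-- Symmetry condition of an elasticity tensor: `a_{ijkl} = a_{jikl} = a_{ijlk}`. -/
def ElastSym {n : ℕ} (A : Fin n → Fin n → Fin n → Fin n → ℝ) : Prop :=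
  ∀ i j k l, A i j k l = A j i k l ∧ A i j k l = A i j l k

/-- The scalar `A x² y² = ∑ a_{ijkl} x_i x_j y_k y_l`. -/
def tQuad {n : ℕ} (A : Fin n → Fin n → Fin n → Fin n → ℝ) (x y : Fin n → ℝ) : ℝ :=
  ∑ i, ∑ j, ∑ k, ∑ l, A i j k l * x i * x j * y k * y l

/-- The vector `(A x y²)_i = ∑ a_{ijkl} x_j y_k y_l`. -/
def tAxyy {n : ℕ} (A : Fin n → Fin n → Fin n → Fin n → ℝ) (x y : Fin n → ℝ) : Fin n → ℝ :=
  fun i => ∑ j, ∑ k, ∑ l, A i j k l * x j * y k * y l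

/-- The vector `(A x² y)_l = ∑ a_{ijkl} x_i x_j y_k`. -/
def tAxxy {n : ℕ} (A : Fin n → Fin n → Fin n → Fin n → ℝ) (x y : Fin n → ℝ) : Fin n → ℝ :=
  fun l => ∑ i, ∑ j, ∑ k, A i j k l * x i * x j * y k

/-- The matrix `(A x²)_{kl} = ∑ a_{ijkl} x_i x_j`. -/
def matAx2 {n : ℕ} (A : Fin n → Fin n → Fin n → Fin n → ℝ) (x : Fin n → ℝ) :
    Matrix (Fin n) (Fin n) ℝ :=
  Matrix.of fun k l => ∑ i, ∑ j, A i j k l * x i * x j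

/-- The matrix `(A y²)_{ij} = ∑ a_{ijkl} y_k y_l`. -/
def matAy2 {n : ℕ} (A : Fin n → Fin n → Fin n → Fin n → ℝ) (y : Fin n → ℝ) :
    Matrix (Fin n) (Fin n) ℝ :=
  Matrix.of fun i j => ∑ k, ∑ l, A i j k l * y k * y l

/-- The identity tensor `e_{ijkl} = 1` iff `i = j` and `k = l`. -/
def idT (n : ℕ) : Fin n → Fin n → Fin n → Fin n → ℝ :=
  fun i j k l => if i = j ∧ k = l then 1 else 0

/-- `xᵀ x = 1`. -/
def unitVec {n : ℕ} (x : Fin n → ℝ) : Prop := ∑ i, x i * x i = 1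

/-- `(λ, x, y)` is an M-eigenpair of `A`. -/
def IsMEig {n : ℕ} (A : Fin n → Fin n → Fin n → Fin n → ℝ) (lam : ℝ) (x y : Fin n → ℝ) :
    Prop :=
  (∀ i, tAxyy A x y i = lam * x i) ∧ (∀ l, tAxxy A x y l = lam * y l) ∧
    unitVec x ∧ unitVec y

/-- M-positive definiteness (the strong ellipticity condition). -/
def MPD {n : ℕ} (A : Fin n → Fin n → Fin n → Fin n → ℝ) : Prop :=
  ∀ x y : Fin n → ℝ, x ≠ 0 → y ≠ 0 → 0 < tQuad A x y

/-- M-positive semidefiniteness. -/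
def MPSD {n : ℕ} (A : Fin n → Fin n → Fin n → Fin n → ℝ) : Prop :=
  ∀ x y : Fin n → ℝ, 0 ≤ tQuad A x y

/-- All entries are nonnegative. -/
def NonnegT {n : ℕ} (A : Fin n → Fin n → Fin n → Fin n → ℝ) : Prop :=
  ∀ i j k l, 0 ≤ A i j k l

/-- The M-spectral radius of a nonnegative elasticity tensor:
`sup { B x² y² : xᵀx = yᵀy = 1 }`. -/
def rhoM {n : ℕ} (B : Fin n → Fin n → Fin n → Fin n → ℝ) : ℝ :=
  sSup { r : ℝ | ∃ x y : Fin n → ℝ, unitVec x ∧ unitVec y ∧ r = tQuad B x y }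

/-- An elasticity Z-tensor: all off-diagonal entries nonpositive. -/
def ZTensor {n : ℕ} (A : Fin n → Fin n → Fin n → Fin n → ℝ) : Prop :=
  ∀ i j k l, ¬(i = j ∧ k = l) → A i j k l ≤ 0

/-- A nonsingular elasticity M-tensor: `A = s E - B` with `B` nonnegative and `s > ρ_M(B)`. -/
def NonsingMT {n : ℕ} (A : Fin n → Fin n → Fin n → Fin n → ℝ) : Prop :=
  ∃ (s : ℝ) (B : Fin n → Fin n → Fin n → Fin n → ℝ),
    ElastSym B ∧ NonnegT B ∧ (∀ i j k l, A i j k l = s * idT n i j k l - B i j k l) ∧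
      rhoM B < s

/-- An elasticity M-tensor: `A = s E - B` with `B` nonnegative and `s ≥ ρ_M(B)`. -/
def ElastMT {n : ℕ} (A : Fin n → Fin n → Fin n → Fin n → ℝ) : Prop :=
  ∃ (s : ℝ) (B : Fin n → Fin n → Fin n → Fin n → ℝ),
    ElastSym B ∧ NonnegT B ∧ (∀ i j k l, A i j k l = s * idT n i j k l - B i j k l) ∧
      rhoM B ≤ s

/-- Irreducibility of a (nonnegative) square matrix. -/
def MatIrred {n : ℕ} (M : Matrix (Fin n) (Fin n) ℝ) : Prop :=
  ∀ S : Finset (Fin n), S.Nonempty → S ≠ Finset.univ → ∃ k ∈ S, ∃ l ∉ S, M k l ≠ 0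

/-- Strict diagonal dominance. -/
def SDD {n : ℕ} (M : Matrix (Fin n) (Fin n) ℝ) : Prop :=
  ∀ i, ∑ j ∈ Finset.univ.erase i, |M i j| < |M i i|

section SymmetricZMatrix

variable {ι : Type*} [Fintype ι]

/-- A nonnegative vector mapped by a Z-matrix to a positive vector is itself positive. -/
lemma pos_of_zmatrix_sum_pos {M : ι → ι → ℝ} (hZ : ∀ k l, k ≠ l → M k l ≤ 0) {y : ι → ℝ}
    (hy : ∀ k, 0 ≤ y k) (hMy : ∀ l, 0 < ∑ k, M k l * y k) (l : ι) : 0 < y l := by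
  refine (hy l).lt_of_ne fun h => ?_
  refine absurd (hMy l) (not_lt.2 (Finset.sum_nonpos fun k _ => ?_))
  by_cases hk : k = l
  · subst hk
    simp [← h]
  · exact mul_nonpos_of_nonpos_of_nonneg (hZ k l hk) (hy k)

/-- A symmetric semipositive Z-matrix is positive definite. -/
lemma quad_pos_of_semipositive {M : ι → ι → ℝ} (hS : ∀ k l, M k l = M l k)
    (hZ : ∀ k l, k ≠ l → M k l ≤ 0) {y : ι → ℝ} (hy : ∀ k, 0 ≤ y k)
    (hMy : ∀ l, 0 < ∑ k, M k l * y k) {z : ι → ℝ} (hz : z ≠ 0) :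
    0 < ∑ k, ∑ l, M k l * z k * z l := by
  have hy' := pos_of_zmatrix_sum_pos hZ hy hMy
  obtain ⟨w, hw⟩ : ∃ w : ι → ℝ, ∀ k, z k = y k * w k :=
    ⟨fun k => z k / y k, fun k => (mul_div_cancel₀ _ (hy' k).ne').symm⟩
  have hcol : ∑ k, ∑ l, M k l * y k * y l * w l ^ 2
      = ∑ l, (∑ k, M k l * y k) * (y l * w l ^ 2) := by
    rw [Finset.sum_comm]
    refine Finset.sum_congr rfl fun l _ => ?_
    rw [Finset.sum_mul]
    exact Finset.sum_congr rfl fun k _ => by ring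
  have hrow : ∑ k, ∑ l, M k l * y k * y l * w k ^ 2
      = ∑ k, ∑ l, M k l * y k * y l * w l ^ 2 := by
    rw [Finset.sum_comm]
    exact Finset.sum_congr rfl fun l _ => Finset.sum_congr rfl fun k _ => by
      rw [hS k l]; ring
  have hpos : 0 < ∑ l, (∑ k, M k l * y k) * (y l * w l ^ 2) := by
    obtain ⟨l, hl⟩ := Function.ne_iff.1 hz
    have hwl : w l ≠ 0 := fun h => hl (by simp [hw, h])
    refine Finset.sum_pos' (fun k _ => mul_nonneg (hMy k).le
      (mul_nonneg (hy k) (sq_nonneg _))) ⟨l, Finset.mem_univ l, ?_⟩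
    have := hMy l
    have := hy' l
    positivity
  have hle : ∑ k, ∑ l, (M k l * y k * y l * w k ^ 2 + M k l * y k * y l * w l ^ 2)
      ≤ ∑ k, ∑ l, 2 * (M k l * z k * z l) := by
    refine Finset.sum_le_sum fun k _ => Finset.sum_le_sum fun l _ => ?_
    rw [hw k, hw l]
    by_cases hkl : k = l
    · subst hkl
      exact le_of_eq (by ring)
    · have h : M k l * (y k * y l * (w k - w l) ^ 2) ≤ 0 :=
        mul_nonpos_of_nonpos_of_nonneg (hZ k l hkl)
          (mul_nonneg (mul_nonneg (hy k) (hy l)) (sq_nonneg _))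
      linarith
  simp only [Finset.sum_add_distrib, ← Finset.mul_sum] at hle
  linarith

/-- A symmetric positive definite Z-matrix is semipositive. -/
lemma exists_pos_of_quad_pos {M : ι → ι → ℝ} (hS : ∀ k l, M k l = M l k)
    (hZ : ∀ k l, k ≠ l → M k l ≤ 0)
    (hP : ∀ z : ι → ℝ, z ≠ 0 → 0 < ∑ k, ∑ l, M k l * z k * z l) :
    ∃ y : ι → ℝ, (∀ k, 0 < y k) ∧ ∀ l, 0 < ∑ k, M k l * y k := by
  have hquad (v u : ι → ℝ) :
      ∑ k, ∑ l, M k l * v k * u l = ∑ k, v k * ((Matrix.of M).mulVec u) k := by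
    refine Finset.sum_congr rfl fun k _ => ?_
    rw [Matrix.mulVec, dotProduct, Finset.mul_sum]
    exact Finset.sum_congr rfl fun l _ => by simp only [Matrix.of_apply]; ring
  have hinj : Function.Injective (Matrix.of M).mulVecLin := by
    rw [← LinearMap.ker_eq_bot, LinearMap.ker_eq_bot']
    intro v hv
    by_contra hne
    have h := hP v hne
    rw [Matrix.mulVecLin_apply] at hv
    rw [hquad, hv] at h
    simp at h
  obtain ⟨y, hy⟩ := LinearMap.injective_iff_surjective.1 hinj (fun _ => 1)
  rw [Matrix.mulVecLin_apply] at hy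
  have hMy (l : ι) : 0 < ∑ k, M k l * y k := by
    have h := congrFun hy l
    simp only [Matrix.mulVec, dotProduct, Matrix.of_apply] at h
    simp only [fun k => hS k l, h, zero_lt_one]
  have hneg : (fun k => (y k)⁻) = 0 := by
    by_contra hne
    have h := hP _ hne
    have hsum : 0 ≤ ∑ k, ∑ l, M k l * (y k)⁻ * y l := by
      rw [hquad (fun k => (y k)⁻) y, hy]
      exact Finset.sum_nonneg fun k _ => by simp
    have hle : ∑ k, ∑ l, M k l * (y k)⁻ * y l
        ≤ ∑ k, ∑ l, -(M k l * (y k)⁻ * (y l)⁻) := by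
      refine Finset.sum_le_sum fun k _ => Finset.sum_le_sum fun l _ => ?_
      have hdec : y l = (y l)⁺ - (y l)⁻ := (posPart_sub_negPart _).symm
      have hcross : M k l * (y k)⁻ * (y l)⁺ ≤ 0 := by
        by_cases hkl : k = l
        · subst hkl
          rcases le_total 0 (y k) with h0 | h0
          · simp [negPart_eq_zero.2 h0]
          · simp [posPart_eq_zero.2 h0]
        · exact mul_nonpos_of_nonpos_of_nonneg
            (mul_nonpos_of_nonpos_of_nonneg (hZ k l hkl) (negPart_nonneg _)) (posPart_nonneg _)
      calc M k l * (y k)⁻ * y l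
          = M k l * (y k)⁻ * (y l)⁺ + -(M k l * (y k)⁻ * (y l)⁻) := by
            conv_lhs => rw [hdec]
            ring
        _ ≤ -(M k l * (y k)⁻ * (y l)⁻) := by linarith
    simp only [Finset.sum_neg_distrib] at hle
    linarith
  have hy0 (k : ι) : 0 ≤ y k := negPart_eq_zero.1 (congrFun hneg k)
  exact ⟨y, pos_of_zmatrix_sum_pos hZ hy0 hMy, hMy⟩

end SymmetricZMatrix

section ElasticityTensor

variable {n : ℕ} {A B : Fin n → Fin n → Fin n → Fin n → ℝ} {x y : Fin n → ℝ}

lemma tAxxy_eq_sum_matAx2 (A : Fin n → Fin n → Fin n → Fin n → ℝ) (x y : Fin n → ℝ)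
    (l : Fin n) : tAxxy A x y l = ∑ k, matAx2 A x k l * y k := by
  simp only [tAxxy, matAx2, Matrix.of_apply, Finset.sum_mul]
  rw [Finset.sum_comm_cycle]

lemma tQuad_eq_sum_matAx2 (A : Fin n → Fin n → Fin n → Fin n → ℝ) (x y : Fin n → ℝ) :
    tQuad A x y = ∑ k, ∑ l, matAx2 A x k l * y k * y l := by
  simp only [tQuad, matAx2, Matrix.of_apply, Finset.sum_mul]
  rw [Finset.sum_comm_cycle]
  refine Finset.sum_congr rfl fun k _ => ?_
  rw [Finset.sum_comm_cycle]

lemma matAx2_symm (hA : ElastSym A) (x : Fin n → ℝ) (k l : Fin n) :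
    matAx2 A x k l = matAx2 A x l k := by
  simp only [matAx2, Matrix.of_apply]
  exact Finset.sum_congr rfl fun i _ => Finset.sum_congr rfl fun j _ => by rw [(hA i j k l).2]

lemma matAx2_offDiag_nonpos (hZ : ZTensor A) (hx : ∀ i, 0 ≤ x i) (k l : Fin n) (hkl : k ≠ l) :
    matAx2 A x k l ≤ 0 := by
  simp only [matAx2, Matrix.of_apply]
  exact Finset.sum_nonpos fun i _ => Finset.sum_nonpos fun j _ =>
    mul_nonpos_of_nonpos_of_nonneg (mul_nonpos_of_nonpos_of_nonneg
      (hZ i j k l fun h => hkl h.2) (hx i)) (hx j)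

lemma tQuad_smul (A : Fin n → Fin n → Fin n → Fin n → ℝ) (x y : Fin n → ℝ) (c d : ℝ) :
    tQuad A (c • x) (d • y) = c ^ 2 * d ^ 2 * tQuad A x y := by
  simp only [tQuad, Finset.mul_sum, Pi.smul_apply, smul_eq_mul]
  exact Finset.sum_congr rfl fun i _ => Finset.sum_congr rfl fun j _ =>
    Finset.sum_congr rfl fun k _ => Finset.sum_congr rfl fun l _ => by ring

lemma tQuad_idT (x y : Fin n → ℝ) :
    tQuad (idT n) x y = (∑ i, x i * x i) * ∑ k, y k * y k := by
  simp only [tQuad, idT, ite_and, ite_mul, one_mul, zero_mul, Finset.sum_ite_irrel,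
    Finset.sum_const_zero, Finset.sum_ite_eq, Finset.mem_univ, if_true]
  rw [Finset.sum_mul_sum]
  exact Finset.sum_congr rfl fun i _ => Finset.sum_congr rfl fun k _ => by ring

lemma tQuad_eq_sub {s : ℝ} (h : ∀ i j k l, A i j k l = s * idT n i j k l - B i j k l)
    (hx : unitVec x) (hy : unitVec y) : tQuad A x y = s - tQuad B x y := by
  have hE : s * tQuad (idT n) x y = s := by
    rw [unitVec] at hx hy
    rw [tQuad_idT, hx, hy]
    ring
  rw [← hE]
  simp only [tQuad, Finset.mul_sum, ← Finset.sum_sub_distrib]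
  exact Finset.sum_congr rfl fun i _ => Finset.sum_congr rfl fun j _ =>
    Finset.sum_congr rfl fun k _ => Finset.sum_congr rfl fun l _ => by rw [h]; ring

lemma tQuad_le_tQuad_abs (hB : NonnegT B) (x y : Fin n → ℝ) :
    tQuad B x y ≤ tQuad B (fun i => |x i|) fun k => |y k| := by
  refine Finset.sum_le_sum fun i _ => Finset.sum_le_sum fun j _ =>
    Finset.sum_le_sum fun k _ => Finset.sum_le_sum fun l _ => ?_
  refine (le_abs_self _).trans_eq ?_
  simp only [abs_mul, abs_of_nonneg (hB i j k l)]

lemma unitVec.abs (hx : unitVec x) : unitVec fun i => |x i| := by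
  simpa [unitVec, abs_mul_abs_self] using hx

lemma unitVec.ne_zero (hx : unitVec x) : x ≠ 0 := by
  rintro rfl
  simp [unitVec] at hx

lemma exists_smul_unitVec (hx : x ≠ 0) : ∃ c : ℝ, c ≠ 0 ∧ unitVec (c • x) := by
  have hpos : 0 < ∑ i, x i * x i := by
    obtain ⟨i, hi⟩ := Function.ne_iff.1 hx
    exact Finset.sum_pos' (fun i _ => mul_self_nonneg _)
      ⟨i, Finset.mem_univ i, mul_self_pos.2 hi⟩
  refine ⟨(√(∑ i, x i * x i))⁻¹, inv_ne_zero (Real.sqrt_pos.2 hpos).ne', ?_⟩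
  simp only [unitVec, Pi.smul_apply, smul_eq_mul, mul_mul_mul_comm _ (x _)]
  rw [← Finset.mul_sum, ← mul_inv, Real.mul_self_sqrt hpos.le, inv_mul_cancel₀ hpos.ne']

lemma isCompact_unitVec : IsCompact {x : Fin n → ℝ | unitVec x} := by
  refine Metric.isCompact_of_isClosed_isBounded
    (isClosed_eq (by fun_prop) continuous_const) ?_
  refine (Metric.isBounded_closedBall (x := (0 : Fin n → ℝ)) (r := 1)).subset fun x hx => ?_
  rw [mem_closedBall_zero_iff, pi_norm_le_iff_of_nonneg zero_le_one]
  intro i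
  rw [Real.norm_eq_abs, ← sq_le_one_iff_abs_le_one, sq]
  exact (Finset.single_le_sum (f := fun i => x i * x i) (fun i _ => mul_self_nonneg _)
    (Finset.mem_univ i)).trans_eq hx

lemma isCompact_tQuad_unitVec (B : Fin n → Fin n → Fin n → Fin n → ℝ) :
    IsCompact {r : ℝ | ∃ x y : Fin n → ℝ, unitVec x ∧ unitVec y ∧ r = tQuad B x y} := by
  have hcont : Continuous fun p : (Fin n → ℝ) × (Fin n → ℝ) => tQuad B p.1 p.2 := by
    unfold tQuad
    fun_prop
  convert (isCompact_unitVec.prod isCompact_unitVec).image hcont using 1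
  ext r
  simp [eq_comm]

lemma tQuad_le_rhoM (B : Fin n → Fin n → Fin n → Fin n → ℝ) (hx : unitVec x)
    (hy : unitVec y) : tQuad B x y ≤ rhoM B :=
  le_csSup (isCompact_tQuad_unitVec B).bddAbove ⟨x, y, hx, hy, rfl⟩

lemma exists_tQuad_eq_rhoM (hn : 1 ≤ n) (B : Fin n → Fin n → Fin n → Fin n → ℝ) :
    ∃ x y : Fin n → ℝ, unitVec x ∧ unitVec y ∧ rhoM B = tQuad B x y := by
  have he : unitVec (Pi.single (⟨0, hn⟩ : Fin n) (1 : ℝ)) := by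
    simp [unitVec, Pi.single_apply]
  exact (isCompact_tQuad_unitVec B).sSup_mem ⟨_, _, _, he, he, rfl⟩

/-- A nonsingular elasticity M-tensor is M-positive definite. -/
lemma NonsingMT.mpd (h : NonsingMT A) : MPD A := by
  obtain ⟨s, B, -, -, hAB, hs⟩ := h
  intro x y hx hy
  obtain ⟨c, hc, hcx⟩ := exists_smul_unitVec hx
  obtain ⟨d, hd, hdy⟩ := exists_smul_unitVec hy
  have hpos : 0 < tQuad A (c • x) (d • y) := by
    rw [tQuad_eq_sub hAB hcx hdy]
    linarith [tQuad_le_rhoM B hcx hdy]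
  rw [tQuad_smul] at hpos
  exact pos_of_mul_pos_right hpos (by positivity)

lemma NonsingMT.exists_pos (hA : ElastSym A) (hZ : ZTensor A) (h : NonsingMT A) (hx : x ≠ 0)
    (hx0 : ∀ i, 0 ≤ x i) : ∃ y : Fin n → ℝ, (∀ i, 0 < y i) ∧ ∀ l, 0 < tAxxy A x y l := by
  simp only [tAxxy_eq_sum_matAx2]
  refine exists_pos_of_quad_pos (matAx2_symm hA x) (matAx2_offDiag_nonpos hZ hx0) fun z hz => ?_
  rw [← tQuad_eq_sum_matAx2]
  exact h.mpd x z hx hz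

/-- A Z-tensor whose quadratic form is positive at all nonzero `x ≥ 0` and `y ≥ 0` is a
nonsingular elasticity M-tensor. -/
lemma nonsingMT_of_tQuad_pos (hn : 1 ≤ n) (hA : ElastSym A) (hZ : ZTensor A)
    (hP : ∀ x y : Fin n → ℝ, x ≠ 0 → y ≠ 0 → (∀ i, 0 ≤ x i) → (∀ i, 0 ≤ y i) →
      0 < tQuad A x y) : NonsingMT A := by
  obtain ⟨s, hs⟩ : ∃ s : ℝ, ∀ i k, A i i k k ≤ s := by
    obtain ⟨s, hs⟩ := (Set.finite_range fun p : Fin n × Fin n => A p.1 p.1 p.2 p.2).bddAbove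
    exact ⟨s, fun i k => hs ⟨(i, k), rfl⟩⟩
  let B : Fin n → Fin n → Fin n → Fin n → ℝ := fun i j k l => s * idT n i j k l - A i j k l
  have hAB (i j k l : Fin n) : A i j k l = s * idT n i j k l - B i j k l := by simp [B]
  have hB : NonnegT B := by
    intro i j k l
    by_cases h : i = j ∧ k = l
    · obtain ⟨rfl, rfl⟩ := h
      simpa [B, idT] using hs i k
    · simpa [B, idT, h] using hZ i j k l h
  refine ⟨s, B, fun i j k l => ?_, hB, hAB, ?_⟩
  · simp only [B, idT, ← (hA i j k l).1, ← (hA i j k l).2, eq_comm, and_self]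
  · obtain ⟨x, y, hx, hy, hxy⟩ := exists_tQuad_eq_rhoM hn B
    have hpos := hP _ _ hx.abs.ne_zero hy.abs.ne_zero (fun i => abs_nonneg (x i))
      fun i => abs_nonneg (y i)
    rw [tQuad_eq_sub hAB hx.abs hy.abs] at hpos
    linarith [tQuad_le_tQuad_abs hB x y]

lemma nonsingMT_of_semipositive (hn : 1 ≤ n) (hA : ElastSym A) (hZ : ZTensor A)
    (h : ∀ x : Fin n → ℝ, x ≠ 0 → (∀ i, 0 ≤ x i) →
      ∃ y : Fin n → ℝ, (∀ i, 0 ≤ y i) ∧ ∀ l, 0 < tAxxy A x y l) : NonsingMT A := by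
  refine nonsingMT_of_tQuad_pos hn hA hZ fun x z hx hz hx0 _ => ?_
  obtain ⟨y, hy, hxy⟩ := h x hx hx0
  simp only [tAxxy_eq_sum_matAx2] at hxy
  rw [tQuad_eq_sum_matAx2]
  exact quad_pos_of_semipositive (matAx2_symm hA x) (matAx2_offDiag_nonpos hZ hx0) hy hxy hz

end ElasticityTensor

/-- semi-positivity characterizations of nonsingular elasticity
M-tensors via `A x² y`. -/
theorem stmt_17 {n : ℕ} (hn : 1 ≤ n) (A : Fin n → Fin n → Fin n → Fin n → ℝ)
    (hA : ElastSym A) (hZ : ZTensor A) :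
    (NonsingMT A ↔ ∀ x : Fin n → ℝ, x ≠ 0 → (∀ i, 0 ≤ x i) →
        ∃ y : Fin n → ℝ, (∀ i, 0 < y i) ∧ ∀ l, 0 < tAxxy A x y l) ∧
    (NonsingMT A ↔ ∀ x : Fin n → ℝ, x ≠ 0 → (∀ i, 0 ≤ x i) →
        ∃ y : Fin n → ℝ, (∀ i, 0 ≤ y i) ∧ ∀ l, 0 < tAxxy A x y l) := by
  have weaken (h : ∀ x : Fin n → ℝ, x ≠ 0 → (∀ i, 0 ≤ x i) →
      ∃ y : Fin n → ℝ, (∀ i, 0 < y i) ∧ ∀ l, 0 < tAxxy A x y l) (x : Fin n → ℝ) (hx : x ≠ 0)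
      (hx0 : ∀ i, 0 ≤ x i) :
      ∃ y : Fin n → ℝ, (∀ i, 0 ≤ y i) ∧ ∀ l, 0 < tAxxy A x y l :=
    let ⟨y, hy, hxy⟩ := h x hx hx0
    ⟨y, fun i => (hy i).le, hxy⟩
  have pos (h : NonsingMT A) (x : Fin n → ℝ) (hx : x ≠ 0) (hx0 : ∀ i, 0 ≤ x i) :=
    h.exists_pos hA hZ hx hx0
  exact ⟨⟨pos, fun h => nonsingMT_of_semipositive hn hA hZ (weaken h)⟩,
    fun h => weaken (pos h), nonsingMT_of_semipositive hn hA hZ⟩
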